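/- Let n ≥ 2 be an integer and c > 0 a real number. The Lebesgue integral of the function x ↦ x_1 + x_2 + ... + x_n over the set {x ∈ [0,c]^n : x_1 + x_2 + ... + x_n ≥ (n-1)c} equals n² c^(n+1) / ((n+1) · n!). -/

import Mathlib

open MeasureTheory

/-- The simplex `{y ∈ ℝⁿ : yᵢ ≥ 0, y₁ + ⋯ + yₙ ≤ t}`. -/
def solidSimplex (n : ℕ) (t : ℝ) : Set (Fin n → ℝ) :=
  {y | (∀ i, 0 ≤ y i) ∧ ∑ i, y i ≤ t}

theorem le_of_mem_solidSimplex {n : ℕ} {t : ℝ} {y : Fin n → ℝ} (hy : y ∈ solidSimplex n t)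
    (i : Fin n) : y i ≤ t :=
  (Finset.single_le_sum (fun j _ => hy.1 j) (Finset.mem_univ i)).trans hy.2

theorem isCompact_solidSimplex (n : ℕ) (t : ℝ) : IsCompact (solidSimplex n t) := by
  refine (isCompact_Icc (a := (0 : Fin n → ℝ)) (b := fun _ => t)).of_isClosed_subset ?_
    fun y hy => ⟨hy.1, le_of_mem_solidSimplex hy⟩
  have h : IsClosed {y : Fin n → ℝ | ∀ i, 0 ≤ y i} := by
    simp only [Set.ofPred_forall]
    exact isClosed_iInter fun i => isClosed_le continuous_const (continuous_apply i)
  have h' : IsClosed {y : Fin n → ℝ | ∑ i, y i ≤ t} :=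
    isClosed_le (by fun_prop) continuous_const
  exact h.inter h'

theorem measurableSet_solidSimplex (n : ℕ) (t : ℝ) : MeasurableSet (solidSimplex n t) :=
  (isCompact_solidSimplex n t).isClosed.measurableSet

theorem integrableOn_solidSimplex_sub_sum_pow (n k : ℕ) (t : ℝ) :
    IntegrableOn (fun y : Fin n → ℝ => (t - ∑ i, y i) ^ k) (solidSimplex n t) :=
  ContinuousOn.integrableOn_compact (isCompact_solidSimplex n t) (by fun_prop)

theorem cons_mem_solidSimplex_iff {n : ℕ} {t s : ℝ} {z : Fin n → ℝ} :
    (Fin.cons s z : Fin (n + 1) → ℝ) ∈ solidSimplex (n + 1) t ↔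
      0 ≤ s ∧ z ∈ solidSimplex n (t - s) := by
  simp only [solidSimplex, Set.mem_ofPred_eq, Fin.forall_fin_succ, Fin.cons_zero, Fin.cons_succ,
    Fin.sum_univ_succ, le_sub_iff_add_le', and_assoc]

/-- The Dirichlet integral of a power of the slack variable over a simplex. -/
theorem integral_solidSimplex_sub_sum_pow (n k : ℕ) {t : ℝ} (ht : 0 ≤ t) :
    ∫ y in solidSimplex n t, (t - ∑ i, y i) ^ k =
      (k.factorial : ℝ) / ((n + k).factorial : ℝ) * t ^ (n + k) := by
  classical
  induction n generalizing t with
  | zero =>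
    have h : solidSimplex 0 t = Set.univ := by
      ext y
      simp [solidSimplex, ht]
    have hk : (k.factorial : ℝ) ≠ 0 := by positivity
    have hv : volume (Set.univ : Set (Fin 0 → ℝ)) = 1 := by
      rw [volume_pi, Measure.pi_of_empty]
      simp
    simp [h, hk, Measure.real, hv]
  | succ n ih =>
    have hslice (s : ℝ) :
        ∫ z : Fin n → ℝ, (solidSimplex (n + 1) t).indicator
            (fun y => (t - ∑ i, y i) ^ k) (Fin.cons s z) =
          (Set.Icc 0 t).indicator (fun s =>
            (k.factorial : ℝ) / ((n + k).factorial : ℝ) * (t - s) ^ (n + k)) s := by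
      by_cases hs : s ∈ Set.Icc 0 t
      · rw [Set.indicator_of_mem hs, ← ih (sub_nonneg.2 hs.2),
          ← integral_indicator (measurableSet_solidSimplex n _)]
        congr 1 with z
        simp only [Set.indicator_apply, cons_mem_solidSimplex_iff, hs.1, true_and,
          Fin.sum_univ_succ, Fin.cons_zero, Fin.cons_succ, sub_sub]
      · rw [Set.indicator_of_notMem hs]
        refine integral_eq_zero_of_ae (.of_forall fun z => Set.indicator_of_notMem ?_ _)
        rw [cons_mem_solidSimplex_iff]
        rintro ⟨h0, hz⟩
        exact hs ⟨h0, sub_nonneg.1 ((Finset.sum_nonneg fun i _ => hz.1 i).trans hz.2)⟩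
    have hmp := (volume_preserving_piFinSuccAbove (fun _ : Fin (n + 1) => ℝ) 0).symm
    have hint := (integrable_indicator_iff (measurableSet_solidSimplex (n + 1) t)).2
      (integrableOn_solidSimplex_sub_sum_pow (n + 1) k t)
    have hint' := (hmp.integrable_comp_emb (MeasurableEquiv.measurableEmbedding _)).2 hint
    rw [← integral_indicator (measurableSet_solidSimplex _ _),
      ← hmp.integral_comp (MeasurableEquiv.measurableEmbedding _)]
    refine (integral_prod _ hint').trans ?_
    simp only [Function.comp_apply, MeasurableEquiv.piFinSuccAbove_symm_apply, Fin.insertNthEquiv,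
      Equiv.coe_fn_mk, Fin.insertNth_zero', hslice]
    rw [integral_indicator measurableSet_Icc, integral_Icc_eq_integral_Ioc,
      ← intervalIntegral.integral_of_le ht, intervalIntegral.integral_const_mul,
      intervalIntegral.integral_comp_sub_left (fun x => x ^ (n + k)), integral_pow,
      show n + 1 + k = n + k + 1 by ring, Nat.factorial_succ]
    have : ((n + k).factorial : ℝ) ≠ 0 := by positivity
    have : ((n : ℝ) + k + 1) ≠ 0 := by positivity
    push_cast
    simp
    field_simp

/-- The reflection `x ↦ c - x` carries the corner of the cube at `(c, …, c)` to a simplex. -/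
theorem const_sub_mem_corner_iff {n : ℕ} {c : ℝ} {y : Fin n → ℝ} :
    (fun _ : Fin n => c) - y ∈
        {x : Fin n → ℝ | (∀ i, x i ∈ Set.Icc 0 c) ∧ ((n : ℝ) - 1) * c ≤ ∑ i, x i} ↔
      y ∈ solidSimplex n c := by
  have hsum : ∑ i, ((fun _ : Fin n => c) - y) i = n * c - ∑ i, y i := by simp
  rw [Set.mem_ofPred_eq, hsum]
  constructor
  · rintro ⟨h, hs⟩
    exact ⟨fun i => by simpa using (h i).2, by linarith⟩
  · intro hy
    refine ⟨fun i => ⟨?_, ?_⟩, by linarith [hy.2]⟩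
    · simpa using le_of_mem_solidSimplex hy i
    · simpa using hy.1 i

/-- The Lebesgue integral of `x ↦ x₁ + ⋯ + xₙ` over
`{x ∈ [0,c]^n : x₁ + ⋯ + xₙ ≥ (n-1)c}` equals `n² c^(n+1) / ((n+1)·n!)`. -/
theorem integral_sum_over_corner_region (n : ℕ) (hn : 2 ≤ n) (c : ℝ) (hc : 0 < c) :
    (∫ x in {x : Fin n → ℝ | (∀ i, x i ∈ Set.Icc 0 c) ∧ ((n : ℝ) - 1) * c ≤ ∑ i, x i},
        (∑ i, x i)) =
      (n : ℝ) ^ 2 * c ^ (n + 1) / (((n : ℝ) + 1) * (Nat.factorial n)) := by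
  classical
  set S := {x : Fin n → ℝ | (∀ i, x i ∈ Set.Icc 0 c) ∧ ((n : ℝ) - 1) * c ≤ ∑ i, x i} with hS
  have hpre : (fun y : Fin n → ℝ => (fun _ => c) - y) ⁻¹' solidSimplex n c = S := by
    ext x
    rw [Set.mem_preimage, ← const_sub_mem_corner_iff, sub_sub_cancel]
  have hmeas : MeasurableSet S :=
    hpre ▸ (measurable_const.sub measurable_id) (measurableSet_solidSimplex n c)
  have hreflect : ∫ x in S, ∑ i, x i =
      ∫ y in solidSimplex n c,
        (((n : ℝ) - 1) * c * (c - ∑ i, y i) ^ 0 + (c - ∑ i, y i) ^ 1) := by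
    rw [← integral_indicator hmeas, ← integral_indicator (measurableSet_solidSimplex n c),
      ← integral_sub_left_eq_self _ volume (fun _ : Fin n => c)]
    congr 1 with y
    simp only [Set.indicator_apply, hS, const_sub_mem_corner_iff]
    congr 1
    simp only [Pi.sub_apply, Finset.sum_sub_distrib, Finset.sum_const, Finset.card_univ,
      Fintype.card_fin, nsmul_eq_mul]
    ring
  rw [hreflect, integral_add ((integrableOn_solidSimplex_sub_sum_pow n 0 c).const_mul _)
    (integrableOn_solidSimplex_sub_sum_pow n 1 c), integral_const_mul,
    integral_solidSimplex_sub_sum_pow n 0 hc.le, integral_solidSimplex_sub_sum_pow n 1 hc.le,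
    Nat.factorial_succ n]
  have : (n.factorial : ℝ) ≠ 0 := by positivity
  push_cast
  simp only [add_zero, Nat.factorial_zero, Nat.factorial_one, Nat.cast_one]
  field_simp
  ring
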